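/- arXiv:math/0412423 — 3 statements merged into one kernel-verified Lean document; each statement's English description precedes it below -/
import Mathlib

section
/- Let P, Q, R, S be four distinct rank-one orthogonal projections on ℂ² (i.e., projections onto four distinct one-dimensional subspaces of ℂ²), and suppose there is a real number a such that tr(XY) = a for every pair of distinct elements X, Y of {P,Q,R,S}. Then a = 1/3; that is, four distinct one-dimensional subspaces of ℂ² all making the same angle with one another must make the angle cos⁻¹(1/√3). -/
open Matrix

/-- The matrix `(1 + u · σ) / 2`, where `σ` is the vector of Pauli matrices. -/
noncomputable def blochMatrix (u : Fin 3 → ℝ) : Matrix (Fin 2) (Fin 2) ℂ :=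
  !![(1 + u 2) / 2, (u 0 - u 1 * Complex.I) / 2;
    (u 0 + u 1 * Complex.I) / 2, (1 - u 2) / 2]

/-- A rank-one projection on `ℂ²` is given by a point of the Bloch sphere. -/
theorem exists_bloch_vector (P : Matrix (Fin 2) (Fin 2) ℂ)
    (hP : Pᴴ = P ∧ P * P = P ∧ P.trace = 1) :
    ∃ u : Fin 3 → ℝ, u ⬝ᵥ u = 1 ∧ P = blochMatrix u := by
  obtain ⟨hH, hI, hT⟩ := hP
  have h00 := congrFun₂ hH 0 0
  have h10 := congrFun₂ hH 1 0
  have hsq := congrFun₂ hI 0 0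
  simp only [conjTranspose_apply, Matrix.mul_apply, Fin.sum_univ_two, Complex.ext_iff,
    Complex.star_def, Complex.conj_re, Complex.conj_im, Complex.add_re, Complex.mul_re]
    at h00 h10 hsq
  simp only [trace_fin_two, Complex.ext_iff, Complex.add_re, Complex.add_im, Complex.one_re,
    Complex.one_im] at hT
  have him : (P 0 0).im = 0 := by linarith [h00.2]
  have hsq' := hsq.1
  rw [← h10.1, ← h10.2, him] at hsq'
  refine ⟨![2 * (P 0 1).re, -2 * (P 0 1).im, 2 * (P 0 0).re - 1], ?_, ?_⟩
  · simp [dotProduct, Fin.sum_univ_three]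
    nlinarith
  · ext i j
    fin_cases i <;> fin_cases j <;> apply Complex.ext <;> simp [blochMatrix] <;> linarith

/-- The trace of a product of rank-one projections in terms of their Bloch vectors. -/
theorem trace_mul_bloch (u v : Fin 3 → ℝ) :
    (blochMatrix u * blochMatrix v).trace = ((1 + u ⬝ᵥ v) / 2 : ℝ) := by
  simp [blochMatrix, trace_fin_two, dotProduct, Fin.sum_univ_three]
  linear_combination (-(u 1 * v 1 : ℂ) / 2) * Complex.I_sq

/-- Four unit vectors in `ℝ³` with equal pairwise inner products `c ≠ 1` have `c = -1/3`. -/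
theorem inner_eq_of_four_equiangular (u : Fin 4 → Fin 3 → ℝ) (c : ℝ) (hc : c ≠ 1)
    (hu : ∀ i j, u i ⬝ᵥ u j = if i = j then 1 else c) : c = -1 / 3 := by
  have hG : (Matrix.of fun i j => u i ⬝ᵥ u j).det = 0 := by
    let U : Matrix (Fin 4) (Fin 4) ℝ := Matrix.of fun i => Fin.cons 0 (u i)
    have hU : U.det = 0 := Matrix.det_eq_zero_of_column_eq_zero 0 fun i => rfl
    have hmul : (Matrix.of fun i j => u i ⬝ᵥ u j) = U * Uᵀ := by
      ext i j
      simp [U, Matrix.mul_apply, dotProduct, Fin.sum_univ_succ]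
    rw [hmul, det_mul, hU, zero_mul]
  have hlit : (Matrix.of fun i j => u i ⬝ᵥ u j) =
      !![1, c, c, c; c, 1, c, c; c, c, 1, c; c, c, c, 1] := by
    ext i j
    fin_cases i <;> fin_cases j <;> simp [hu]
  rw [hlit] at hG
  have hdet : (1 - c) ^ 3 * (1 + 3 * c) = 0 := by
    rw [← hG]
    simp [det_succ_row_zero, Fin.sum_univ_succ, Fin.succAbove]
    ring
  have hc' : (1 - c) ^ 3 ≠ 0 := pow_ne_zero _ (sub_ne_zero.2 hc.symm)
  linarith [(mul_eq_zero.1 hdet).resolve_left hc']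

/-- Four distinct rank-one orthogonal projections on ℂ² all making the same
angle with one another must satisfy tr(XY) = 1/3 for each distinct pair,
i.e. the common angle is cos⁻¹(1/√3). -/
theorem four_equiangular_projections_angle
    (P Q R S : Matrix (Fin 2) (Fin 2) ℂ)
    (hP : Pᴴ = P ∧ P * P = P ∧ P.trace = 1)
    (hQ : Qᴴ = Q ∧ Q * Q = Q ∧ Q.trace = 1)
    (hR : Rᴴ = R ∧ R * R = R ∧ R.trace = 1)
    (hS : Sᴴ = S ∧ S * S = S ∧ S.trace = 1)
    (hdist : P ≠ Q ∧ P ≠ R ∧ P ≠ S ∧ Q ≠ R ∧ Q ≠ S ∧ R ≠ S)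
    (a : ℝ)
    (hangle : ∀ X ∈ ({P, Q, R, S} : Set (Matrix (Fin 2) (Fin 2) ℂ)),
      ∀ Y ∈ ({P, Q, R, S} : Set (Matrix (Fin 2) (Fin 2) ℂ)),
        X ≠ Y → (X * Y).trace = (a : ℂ)) :
    a = 1 / 3 := by
  obtain ⟨u, hu, rfl⟩ := exists_bloch_vector P hP
  obtain ⟨v, hv, rfl⟩ := exists_bloch_vector Q hQ
  obtain ⟨w, hw, rfl⟩ := exists_bloch_vector R hR
  obtain ⟨t, ht, rfl⟩ := exists_bloch_vector S hS
  obtain ⟨h1, h2, h3, h4, h5, h6⟩ := hdist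
  have e1 := hangle _ (by simp) _ (by simp) h1
  have e2 := hangle _ (by simp) _ (by simp) h2
  have e3 := hangle _ (by simp) _ (by simp) h3
  have e4 := hangle _ (by simp) _ (by simp) h4
  have e5 := hangle _ (by simp) _ (by simp) h5
  have e6 := hangle _ (by simp) _ (by simp) h6
  rw [trace_mul_bloch, Complex.ofReal_inj] at e1 e2 e3 e4 e5 e6
  have hc : 2 * a - 1 ≠ 1 := by
    intro hc
    have huv : u = v := by
      rw [← sub_eq_zero, ← dotProduct_self_eq_zero]
      simp only [sub_dotProduct, dotProduct_sub, dotProduct_comm v u]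
      linarith
    exact h1 (by rw [huv])
  have := inner_eq_of_four_equiangular ![u, v, w, t] (2 * a - 1) hc (by
    intro i j
    fin_cases i <;> fin_cases j <;> simp <;>
      first
      | linarith
      | (rw [dotProduct_comm]; linarith))
  linarith
end

section
/- For each pair of integers (b, c) with b ∈ {2,3,4} and c ∈ {0,1}, define f_{b,c}(x) = cx² + (b−5c)x + (2−3b+6c) + (b−c−1)/x for x > 0. If α, β are real numbers with α ≥ 2, β ≥ 2, f_{b,c}(α) = β and f_{b,c}(β) = α, then α = β. -/
/-- For b ∈ {2,3,4} and c ∈ {0,1}, if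
f_{b,c}(x) = cx² + (b−5c)x + (2−3b+6c) + (b−c−1)/x satisfies
f_{b,c}(α) = β and f_{b,c}(β) = α with α, β ≥ 2, then α = β. -/
theorem f_bc_swap_implies_eq (b c : ℤ)
    (hb : b ∈ ({2, 3, 4} : Set ℤ)) (hc : c ∈ ({0, 1} : Set ℤ))
    (f : ℝ → ℝ)
    (hf : ∀ x : ℝ, x > 0 →
      f x = (c : ℝ) * x ^ 2 + ((b : ℝ) - 5 * (c : ℝ)) * x +
        (2 - 3 * (b : ℝ) + 6 * (c : ℝ)) + ((b : ℝ) - (c : ℝ) - 1) / x)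
    (α β : ℝ) (hα : 2 ≤ α) (hβ : 2 ≤ β)
    (h1 : f α = β) (h2 : f β = α) : α = β := by
  have hα0 : 0 < α := by linarith
  have hβ0 : 0 < β := by linarith
  rw [hf α hα0] at h1
  rw [hf β hβ0] at h2
  field_simp at h1 h2
  have hfactor : (α - β) * (α * β * ((c : ℝ) * (α + β) + ((b : ℝ) - 5 * c) + 1)
      - ((b : ℝ) - c - 1)) = 0 := by
    linear_combination β * h1 - α * h2
  have hprod : 4 ≤ α * β := by nlinarith
  rcases mul_eq_zero.mp hfactor with h | h
  · linarith
  · exfalso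
    have hsum : 4 * (α * β) ≤ α * β * (α + β) := by nlinarith
    rcases hb with rfl | rfl | rfl <;> rcases hc with rfl | rfl <;>
      push_cast at h <;> nlinarith
end

section
/- The polynomial x³ − 2x² − 4x + 2 has a largest real root, and this largest real root lies strictly between 3 and 4cos²(π/7). That is, there exists a real number x₀ with x₀³ − 2x₀² − 4x₀ + 2 = 0 and 3 < x₀ < 4cos²(π/7), such that every real root of the polynomial is at most x₀. (Hence the largest root is not an admissible Jones index value.) -/
/-- `16/5 < 4cos²(π/7)`. -/
lemma sixteen_fifths_lt_four_mul_cos_sq_pi_div_seven :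
    (16 / 5 : ℝ) < 4 * Real.cos (Real.pi / 7) ^ 2 := by
  have hpi := Real.pi_lt_d2
  have hpos := Real.pi_pos
  have hcos := Real.one_sub_sq_div_two_le_cos (x := Real.pi / 7)
  have hc : (0.895 : ℝ) < Real.cos (Real.pi / 7) := by nlinarith
  nlinarith

/-- The cubic is strictly increasing on `[3, ∞)`. -/
lemma strictMonoOn_index_cubic :
    StrictMonoOn (fun x : ℝ => x ^ 3 - 2 * x ^ 2 - 4 * x + 2) (Set.Ici 3) := by
  intro a ha b hb hab
  rw [Set.mem_Ici] at ha hb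
  have hq : 0 < b ^ 2 + b * a + a ^ 2 - 2 * (b + a) - 4 := by nlinarith
  dsimp only
  linear_combination mul_pos (sub_pos.mpr hab) hq

/-- The polynomial x³ − 2x² − 4x + 2 has a largest real root, lying strictly
between 3 and 4cos²(π/7); hence the largest root is not an admissible Jones
index value. -/
theorem largest_root_between_three_and_4cos2_pi7 :
    ∃ x₀ : ℝ, x₀ ^ 3 - 2 * x₀ ^ 2 - 4 * x₀ + 2 = 0 ∧
      3 < x₀ ∧ x₀ < 4 * Real.cos (Real.pi / 7) ^ 2 ∧
      ∀ x : ℝ, x ^ 3 - 2 * x ^ 2 - 4 * x + 2 = 0 → x ≤ x₀ := by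
  have hcont : ContinuousOn (fun x : ℝ => x ^ 3 - 2 * x ^ 2 - 4 * x + 2)
      (Set.Icc 3 (16 / 5)) := by fun_prop
  obtain ⟨x₀, ⟨hlo, hhi⟩, hroot⟩ :=
    intermediate_value_Ioo (by norm_num) hcont
      (show (0 : ℝ) ∈ Set.Ioo _ _ by constructor <;> norm_num)
  refine ⟨x₀, hroot, hlo, hhi.trans sixteen_fifths_lt_four_mul_cos_sq_pi_div_seven, ?_⟩
  intro x hx
  by_contra! hlt
  exact (strictMonoOn_index_cubic hlo.le (hlo.trans hlt).le hlt).ne (hroot.trans hx.symm)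
end
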